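/- (Integrated dissipation inequality) Under the hypotheses of Lemma 1 (Assumption 1 holds and x, x⋆ are differentiable solutions of the bilinear system and of the reference dynamics), for all 0 ≤ t₀ ≤ t₁: V(x̃(t₁)) − V(x̃(t₀)) ≤ ∫_{t₀}^{t₁} ũ(s)ᵀy(s) ds, where V(x̃) = (1/2)x̃ᵀPx̃, x̃ = x − x⋆, ũ = u − u⋆ and y = C(x⋆)x. -/

import Mathlib

open Matrix

/-- The symmetric part of a square real matrix: `sym M = (1/2)(M + Mᵀ)`. -/
noncomputable def sym {k : ℕ} (M : Matrix (Fin k) (Fin k) ℝ) : Matrix (Fin k) (Fin k) ℝ :=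
  (1 / 2 : ℝ) • (M + Mᵀ)

/-- The quadratic form of a matrix only sees its symmetric part. -/
theorem dotProduct_sym_mulVec {k : ℕ} (M : Matrix (Fin k) (Fin k) ℝ) (v : Fin k → ℝ) :
    v ⬝ᵥ (sym M *ᵥ v) = v ⬝ᵥ (M *ᵥ v) := by
  have h : v ⬝ᵥ (Mᵀ *ᵥ v) = v ⬝ᵥ (M *ᵥ v) := by
    rw [mulVec_transpose, dotProduct_comm, dotProduct_mulVec]
  rw [sym, smul_mulVec, add_mulVec, dotProduct_smul, dotProduct_add, h, smul_eq_mul]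
  ring

/-- A matrix with vanishing symmetric part is skew-symmetric. -/
theorem transpose_eq_neg_of_sym_eq_zero {k : ℕ} {M : Matrix (Fin k) (Fin k) ℝ}
    (h : sym M = 0) : Mᵀ = -M := by
  rw [sym, smul_eq_zero_iff_right (by norm_num)] at h
  exact eq_neg_of_add_eq_zero_right h

theorem dotProduct_mulVec_mulVec_comm {k : ℕ} {P : Matrix (Fin k) (Fin k) ℝ} (hP : Pᵀ = P)
    (v w : Fin k → ℝ) : v ⬝ᵥ (P *ᵥ w) = w ⬝ᵥ (P *ᵥ v) := by
  rw [dotProduct_mulVec, dotProduct_comm, ← mulVec_transpose, hP]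

theorem HasDerivAt.dotProduct_pi {ι : Type*} [Fintype ι] {f g : ℝ → ι → ℝ} {f' g' : ι → ℝ}
    {t : ℝ} (hf : HasDerivAt f f' t) (hg : HasDerivAt g g' t) :
    HasDerivAt (fun s => f s ⬝ᵥ g s) (f' ⬝ᵥ g t + f t ⬝ᵥ g') t := by
  simp only [dotProduct, ← Finset.sum_add_distrib]
  exact HasDerivAt.fun_sum fun i _ => (hasDerivAt_pi.1 hf i).mul (hasDerivAt_pi.1 hg i)

/-- The quadratic storage function of a symmetric matrix has the expected derivative. -/
theorem HasDerivAt.half_quadratic {k : ℕ} {P : Matrix (Fin k) (Fin k) ℝ} (hP : Pᵀ = P)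
    {z : ℝ → Fin k → ℝ} {z' : Fin k → ℝ} {t : ℝ} (hz : HasDerivAt z z' t) :
    HasDerivAt (fun s => (1 / 2 : ℝ) * (z s ⬝ᵥ (P *ᵥ z s))) (z t ⬝ᵥ (P *ᵥ z')) t := by
  have hPz : HasDerivAt (fun s => P *ᵥ z s) (P *ᵥ z') t :=
    (Matrix.mulVecLin P).toContinuousLinearMap.hasFDerivAt.comp_hasDerivAt t hz
  refine ((hz.dotProduct_pi hPz).const_mul (1 / 2 : ℝ)).congr_deriv ?_
  rw [dotProduct_mulVec_mulVec_comm hP z' (z t)]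
  ring

/-- If `sym (P * B) = 0`, the power supplied through `B` is the input times the output. -/
theorem dotProduct_skew_input {k : ℕ} {P B : Matrix (Fin k) (Fin k) ℝ} (hP : Pᵀ = P)
    (hPB : sym (P * B) = 0) (a b : ℝ) (v w : Fin k → ℝ) :
    (v - w) ⬝ᵥ (P *ᵥ (a • (B *ᵥ v) - b • (B *ᵥ w))) =
      (a - b) * (w ⬝ᵥ (Bᵀ *ᵥ (P *ᵥ v))) := by
  have hskew := transpose_eq_neg_of_sym_eq_zero hPB
  have hdiag : ∀ q : Fin k → ℝ, q ⬝ᵥ ((P * B) *ᵥ q) = 0 := fun q => by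
    rw [← dotProduct_sym_mulVec, hPB, zero_mulVec, dotProduct_zero]
  have hcross : v ⬝ᵥ ((P * B) *ᵥ w) = -(w ⬝ᵥ ((P * B) *ᵥ v)) := by
    rw [dotProduct_mulVec, dotProduct_comm, ← mulVec_transpose, hskew, neg_mulVec,
      dotProduct_neg]
  have hout : w ⬝ᵥ (Bᵀ *ᵥ (P *ᵥ v)) = -(w ⬝ᵥ ((P * B) *ᵥ v)) := by
    have hBP : Bᵀ * P = -(P * B) := by rw [← hskew, transpose_mul, hP]
    rw [mulVec_mulVec, hBP, neg_mulVec, dotProduct_neg]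
  rw [hout]
  simp only [mulVec_sub, mulVec_smul, mulVec_mulVec, sub_dotProduct, dotProduct_sub,
    dotProduct_smul, smul_eq_mul, hdiag, hcross]
  ring

/-- **integrated dissipation inequality.** Under the hypotheses of Lemma 1
(Assumption 1: `P = Pᵀ > 0`, `sym(P A) ≤ 0`, `sym(P Bᵢ) = 0`; `x`, `x⋆` differentiable
solutions of the bilinear system and reference dynamics, with continuous controls), for all
`0 ≤ t₀ ≤ t₁`: `V(x̃(t₁)) − V(x̃(t₀)) ≤ ∫_{t₀}^{t₁} ũ(s)ᵀ y(s) ds`, where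
`V(x̃) = (1/2) x̃ᵀ P x̃`, `x̃ = x − x⋆`, `ũ = u − u⋆` and `yᵢ = x⋆ᵀ Bᵢᵀ P x`. -/
theorem stmt_5 {n m : ℕ}
    (A : Matrix (Fin n) (Fin n) ℝ) (B : Fin m → Matrix (Fin n) (Fin n) ℝ)
    (P : Matrix (Fin n) (Fin n) ℝ) (hP : P.PosDef)
    (hPA : (-sym (P * A)).PosSemidef)
    (hPB : ∀ i, sym (P * B i) = 0)
    (d : ℝ → Fin n → ℝ)
    (x xs : ℝ → Fin n → ℝ) (u us : ℝ → Fin m → ℝ)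
    (hu : Continuous u) (hus : Continuous us)
    (hxsb : ∃ M, ∀ t, ‖xs t‖ ≤ M) (husb : ∃ M, ∀ t, ‖us t‖ ≤ M)
    (hx : ∀ t, HasDerivAt x (A *ᵥ x t + d t + ∑ i, u t i • (B i *ᵥ x t)) t)
    (hxs : ∀ t, HasDerivAt xs (A *ᵥ xs t + d t + ∑ i, us t i • (B i *ᵥ xs t)) t)
    (y : ℝ → Fin m → ℝ)
    (hy : ∀ t i, y t i = xs t ⬝ᵥ ((B i)ᵀ *ᵥ (P *ᵥ x t))) :
    ∀ t₀ t₁ : ℝ, 0 ≤ t₀ → t₀ ≤ t₁ →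
      (1 / 2 : ℝ) * ((x t₁ - xs t₁) ⬝ᵥ (P *ᵥ (x t₁ - xs t₁)))
        - (1 / 2 : ℝ) * ((x t₀ - xs t₀) ⬝ᵥ (P *ᵥ (x t₀ - xs t₀)))
        ≤ ∫ s in t₀..t₁, (u s - us s) ⬝ᵥ y s := by
  intro t₀ t₁ _ h01
  have hPT : Pᵀ = P := by simpa using hP.isHermitian.eq
  have hderiv := fun t => ((hx t).sub (hxs t)).half_quadratic hPT
  have hxc : Continuous x := continuous_iff_continuousAt.2 fun t => (hx t).continuousAt
  have hxsc : Continuous xs := continuous_iff_continuousAt.2 fun t => (hxs t).continuousAt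
  have hyc : Continuous y := by
    refine continuous_pi fun i => ?_
    simp only [hy]
    fun_prop
  have hsupply : Continuous fun s => (u s - us s) ⬝ᵥ y s := by fun_prop
  refine intervalIntegral.sub_le_integral_of_hasDeriv_right_of_le h01
    (fun t _ => (hderiv t).continuousAt.continuousWithinAt)
    (fun t _ => (hderiv t).hasDerivWithinAt)
    (hsupply.integrableOn_Icc) fun t _ => ?_
  have hA : (x t - xs t) ⬝ᵥ (P *ᵥ (A *ᵥ (x t - xs t))) ≤ 0 := by
    have h := hPA.dotProduct_mulVec_nonneg (x t - xs t)
    rw [star_trivial, neg_mulVec, dotProduct_neg, dotProduct_sym_mulVec, ← mulVec_mulVec] at h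
    linarith
  have hsplit : A *ᵥ x t + d t + ∑ i, u t i • (B i *ᵥ x t) -
      (A *ᵥ xs t + d t + ∑ i, us t i • (B i *ᵥ xs t)) =
      A *ᵥ (x t - xs t) + ∑ i, (u t i • (B i *ᵥ x t) - us t i • (B i *ᵥ xs t)) := by
    rw [mulVec_sub, Finset.sum_sub_distrib]
    abel
  have hB : (x t - xs t) ⬝ᵥ
      (P *ᵥ ∑ i, (u t i • (B i *ᵥ x t) - us t i • (B i *ᵥ xs t))) =
      (u t - us t) ⬝ᵥ y t := by
    rw [mulVec_sum, dotProduct_sum]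
    refine Finset.sum_congr rfl fun i _ => ?_
    rw [dotProduct_skew_input hPT (hPB i), hy, Pi.sub_apply]
  rw [hsplit, mulVec_add, dotProduct_add, Pi.sub_apply, hB]
  linarith
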